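/- arXiv:2409.10745 — 3 statements merged into one kernel-verified Lean document; each statement's English description precedes it below -/
import Mathlib

section
/- Let (X,G,α) be a topological dynamical system and let 𝒰 be an open cover of X. Then there exists a sequence 𝔰 = (g_i)_{i∈ℕ} of pairwise distinct elements of G such that the maximal pattern entropy of 𝒰 equals the topological sequence entropy of 𝒰 along 𝔰, i.e. h*_{top}(𝒰,G) = h^𝔰_{top}(𝒰,G). -/
open Filter Topology Set
open scoped ENNReal Classical

section EntropyDefs

variable {G X : Type*}

/-- `𝒰` is an open cover of `X`. -/
def IsOpenCover [TopologicalSpace X] (𝒰 : Set (Set X)) : Prop :=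
  (∀ U ∈ 𝒰, IsOpen U) ∧ ⋃₀ 𝒰 = Set.univ

/-- `N(𝒰)`: the minimal cardinality of a finite subcover of `𝒰`
(junk value `0` if no finite subcover exists). -/
noncomputable def coverN (𝒰 : Set (Set X)) : ℕ :=
  sInf {n : ℕ | ∃ F : Finset (Set X), ↑F ⊆ 𝒰 ∧ F.card = n ∧ ⋃₀ (F : Set (Set X)) = Set.univ}

/-- The join `⋁_{i=1}^n α_{g_i⁻¹}(𝒰)` of the covers `α_{g_i⁻¹}(𝒰) = (α g_i)⁻¹'(𝒰)`. -/
def joinPull (α : G → X → X) (𝒰 : Set (Set X)) {n : ℕ} (g : Fin n → G) : Set (Set X) :=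
  {V | ∃ U : Fin n → Set X, (∀ i, U i ∈ 𝒰) ∧ V = ⋂ i, α (g i) ⁻¹' U i}

/-- Topological sequence entropy of the cover `𝒰` along the sequence `𝔰`:
`h_top^𝔰(𝒰,G) = limsup_n (1/n) log N(⋁_{i=1}^n α_{𝔰(i)⁻¹}(𝒰))`, valued in `[0,∞]`. -/
noncomputable def seqEntCover (α : G → X → X) (𝔰 : ℕ → G) (𝒰 : Set (Set X)) : ℝ≥0∞ :=
  Filter.atTop.limsup fun n : ℕ =>
    ENNReal.ofReal (Real.log (coverN (joinPull α 𝒰 fun i : Fin n => 𝔰 i)) / n)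

/-- Topological sequence entropy of the action along `𝔰`: supremum over all open covers. -/
noncomputable def seqEnt [TopologicalSpace X] (α : G → X → X) (𝔰 : ℕ → G) : ℝ≥0∞ :=
  ⨆ 𝒰 ∈ {𝒰 : Set (Set X) | IsOpenCover 𝒰}, seqEntCover α 𝔰 𝒰

/-- `p*_{X,G,𝒰}(n) = max_{(g_1,…,g_n) ∈ Gⁿ} N(⋁_{i=1}^n α_{g_i⁻¹}(𝒰))`. -/
noncomputable def patN (α : G → X → X) (𝒰 : Set (Set X)) (n : ℕ) : ℕ :=
  sSup {m : ℕ | ∃ g : Fin n → G, m = coverN (joinPull α 𝒰 g)}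

/-- Maximal pattern entropy of the cover `𝒰`: `lim_n (1/n) log p*_{X,G,𝒰}(n)`
(the limit exists by subadditivity and coincides with the limsup used here). -/
noncomputable def patEntCover (α : G → X → X) (𝒰 : Set (Set X)) : ℝ≥0∞ :=
  Filter.atTop.limsup fun n : ℕ => ENNReal.ofReal (Real.log (patN α 𝒰 n) / n)

/-- Maximal pattern entropy `h*_top(X,G)`: supremum over all open covers. -/
noncomputable def patEnt [TopologicalSpace X] (α : G → X → X) : ℝ≥0∞ :=
  ⨆ 𝒰 ∈ {𝒰 : Set (Set X) | IsOpenCover 𝒰}, patEntCover α 𝒰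

/-- `α` is an action of `G` on `X` by homeomorphisms. -/
def IsActionBy [Group G] [TopologicalSpace X] (α : G → X → X) : Prop :=
  (∀ x, α 1 x = x) ∧ (∀ g h x, α (g * h) x = α g (α h x)) ∧ ∀ g, Continuous (α g)

/-- `I ⊆ G` is an independence set for the tuple `(A 1, …, A k)`:
for every nonempty finite `F ⊆ I` and every `ω : F → {1,…,k}` we have
`⋂_{g ∈ F} α_{g⁻¹}(A (ω g)) ≠ ∅`. -/
def IsIndepSet (α : G → X → X) {k : ℕ} (A : Fin k → Set X) (I : Set G) : Prop :=
  ∀ F : Finset G, ↑F ⊆ I → F.Nonempty → ∀ ω : G → Fin k,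
    (⋂ g ∈ F, α g ⁻¹' A (ω g)).Nonempty

/-- The tuple `(A 1, …, A k)` has arbitrarily large finite independence sets. -/
def HasArbLargeIndep (α : G → X → X) {k : ℕ} (A : Fin k → Set X) : Prop :=
  ∀ n : ℕ, ∃ F : Finset G, n ≤ F.card ∧ IsIndepSet α A ↑F

/-- `(x 1, …, x k)` is an IN-tuple: every product neighbourhood has arbitrarily large
finite independence sets. -/
def IsINTuple [TopologicalSpace X] (α : G → X → X) {k : ℕ} (x : Fin k → X) : Prop :=
  ∀ U : Fin k → Set X, (∀ i, IsOpen (U i)) → (∀ i, x i ∈ U i) → HasArbLargeIndep α U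

/-- The action `α` of `G` on `X` is (topologically) weak-mixing. -/
def IsWeakMixing [TopologicalSpace X] (α : G → X → X) : Prop :=
  ∀ U₁ U₂ V₁ V₂ : Set X, IsOpen U₁ → IsOpen U₂ → IsOpen V₁ → IsOpen V₂ →
    U₁.Nonempty → U₂.Nonempty → V₁.Nonempty → V₂.Nonempty →
    ∃ g : G, (U₁ ∩ α g '' V₁).Nonempty ∧ (U₂ ∩ α g '' V₂).Nonempty

/-- `(x₁,x₂)` is a sequence entropy pair. -/
def IsSeqEntropyPair [TopologicalSpace X] (α : G → X → X) (x₁ x₂ : X) : Prop :=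
  x₁ ≠ x₂ ∧ ∀ A₁ A₂ : Set X, IsClosed A₁ → IsClosed A₂ →
    A₁ ∈ nhds x₁ → A₂ ∈ nhds x₂ → Disjoint A₁ A₂ →
    ∃ 𝔰 : ℕ → G, 0 < seqEntCover α 𝔰 {A₁ᶜ, A₂ᶜ}

/-- `(x 1, …, x k)` is a sequence entropy tuple: it is not diagonal, and whenever
`U i` are closed neighbourhoods of the `x i` which coincide on equal coordinates and are
pairwise disjoint on distinct coordinates (i.e. pairwise disjoint closed neighbourhoods of
the distinct points of the tuple), some sequence gives positive sequence entropy for the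
cover by their complements. -/
def IsSeqEntropyTuple [TopologicalSpace X] (α : G → X → X) {k : ℕ} (x : Fin k → X) : Prop :=
  (∃ i j, x i ≠ x j) ∧ ∀ U : Fin k → Set X,
    (∀ i, IsClosed (U i)) → (∀ i, U i ∈ nhds (x i)) →
    (∀ i j, x i = x j → U i = U j) → (∀ i j, x i ≠ x j → Disjoint (U i) (U j)) →
    ∃ 𝔰 : ℕ → G, 0 < seqEntCover α 𝔰 (Set.range fun i => (U i)ᶜ)

end EntropyDefs

namespace CoInd

variable {G : Type*} [Group G] (H : Subgroup G)

/-- `H\G`, the space of right cosets of `H` in `G`. -/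
abbrev RQ := Quotient (QuotientGroup.rightRel H)

/-- Right multiplication `Hg ↦ H(g·g₀)` on the right coset space. -/
def rmul (g₀ : G) : RQ H → RQ H :=
  Quotient.map' (fun g => g * g₀) (fun a b hab => by
    rw [QuotientGroup.rightRel_apply] at hab ⊢
    have h2 : b * g₀ * (a * g₀)⁻¹ = b * a⁻¹ := by group
    rw [h2]; exact hab)

/-- `s : H\G → G` is a section of the right cosets with `s(H) = e`. -/
def IsSection (s : RQ H → G) : Prop :=
  (∀ θ : RQ H, Quotient.mk'' (s θ) = θ) ∧ s (Quotient.mk'' 1) = 1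

variable {X : Type*}

/-- The co-induced action `α^{H\G}` of `G` on `X_H^G = ∏_{θ ∈ H\G} X`, relative to a
section `s` of the right cosets:
`(α^{H\G}_{g₀} f)(Hg) = α_{s(Hg)·g₀·s(Hg·g₀)⁻¹} (f (Hg·g₀))`.
(When `s` is a genuine section the element `s(Hg)·g₀·s(Hg·g₀)⁻¹` always lies in `H`,
so the `else` branch is never taken.) -/
noncomputable def coindAct (α : ↥H → X → X) (s : RQ H → G) (g₀ : G)
    (f : RQ H → X) : RQ H → X := fun θ =>
  if h : s θ * g₀ * (s (rmul H g₀ θ))⁻¹ ∈ H then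
    α ⟨s θ * g₀ * (s (rmul H g₀ θ))⁻¹, h⟩ (f (rmul H g₀ θ))
  else f (rmul H g₀ θ)

end CoInd

/-- `𝒰` has a finite subcover, so that `coverN 𝒰` is not a junk value. -/
def HasFiniteSubcover {X : Type*} (𝒰 : Set (Set X)) : Prop :=
  ∃ F : Finset (Set X), ↑F ⊆ 𝒰 ∧ ⋃₀ (F : Set (Set X)) = Set.univ

lemma coverN_le_card {X : Type*} {𝒰 : Set (Set X)} (F : Finset (Set X)) (hF : ↑F ⊆ 𝒰)
    (hc : ⋃₀ (F : Set (Set X)) = Set.univ) : coverN 𝒰 ≤ F.card :=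
  Nat.sInf_le ⟨F, hF, rfl, hc⟩

lemma HasFiniteSubcover.exists_card_eq_coverN {X : Type*} {𝒰 : Set (Set X)}
    (h : HasFiniteSubcover 𝒰) :
    ∃ F : Finset (Set X), ↑F ⊆ 𝒰 ∧ F.card = coverN 𝒰 ∧ ⋃₀ (F : Set (Set X)) = Set.univ := by
  obtain ⟨F, hF, hc⟩ := h
  exact Nat.sInf_mem (s := {n : ℕ | ∃ F : Finset (Set X), ↑F ⊆ 𝒰 ∧ F.card = n ∧
    ⋃₀ (F : Set (Set X)) = Set.univ}) ⟨F.card, F, hF, rfl, hc⟩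

/-- If the pullback of `𝒱` along some self-map refines `𝒲`, then `N(𝒲) ≤ N(𝒱)`. -/
lemma coverN_le_coverN_of_preimage_subset {X : Type*} {𝒱 𝒲 : Set (Set X)}
    (hfin : HasFiniteSubcover 𝒱) (f : X → X) (h : ∀ V ∈ 𝒱, ∃ W ∈ 𝒲, f ⁻¹' V ⊆ W) :
    coverN 𝒲 ≤ coverN 𝒱 := by
  obtain ⟨F, hF, hcard, hc⟩ := hfin.exists_card_eq_coverN
  choose! φ hφ hsub using h
  rw [← hcard]
  refine (coverN_le_card (F.image φ) ?_ ?_).trans Finset.card_image_le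
  · intro W hW
    obtain ⟨V, hV, rfl⟩ := Finset.mem_image.1 (Finset.mem_coe.1 hW)
    exact hφ V (hF hV)
  · refine Set.eq_univ_of_forall fun x => ?_
    obtain ⟨V, hV, hx⟩ := (Set.eq_univ_iff_forall.1 hc) (f x)
    exact ⟨φ V, Finset.mem_coe.2 (Finset.mem_image_of_mem φ hV), hsub V (hF hV) hx⟩

lemma IsOpenCover.hasFiniteSubcover {X : Type*} [TopologicalSpace X] [CompactSpace X]
    {𝒰 : Set (Set X)} (h : IsOpenCover 𝒰) : HasFiniteSubcover 𝒰 := by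
  obtain ⟨T, hT, hfin, hc⟩ := isCompact_univ.elim_finite_subcover_image (c := id) h.1
    (by simpa [Set.sUnion_eq_biUnion] using h.2.ge)
  exact ⟨hfin.toFinset, by simpa using hT, by
    simpa [Set.sUnion_eq_biUnion] using Set.univ_subset_iff.1 hc⟩

/-- A finite subcover of `𝒰` with `c` elements yields one of the join of `n` pullbacks with
at most `c ^ n` elements. -/
lemma exists_subcover_joinPull {G X : Type*} (α : G → X → X) {𝒰 : Set (Set X)}
    {F : Finset (Set X)} (hF : ↑F ⊆ 𝒰) (hc : ⋃₀ (F : Set (Set X)) = Set.univ)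
    {n : ℕ} (g : Fin n → G) :
    ∃ F' : Finset (Set X), ↑F' ⊆ joinPull α 𝒰 g ∧ ⋃₀ (F' : Set (Set X)) = Set.univ ∧
      F'.card ≤ F.card ^ n := by
  refine ⟨(Fintype.piFinset fun _ : Fin n => F).image fun U => ⋂ i, α (g i) ⁻¹' U i, ?_, ?_, ?_⟩
  · intro W hW
    obtain ⟨U, hU, rfl⟩ := Finset.mem_image.1 (Finset.mem_coe.1 hW)
    exact ⟨U, fun i => hF (Fintype.mem_piFinset.1 hU i), rfl⟩
  · refine Set.eq_univ_of_forall fun x => ?_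
    choose U hU hx using fun i => (Set.eq_univ_iff_forall.1 hc) (α (g i) x)
    exact ⟨_, Finset.mem_coe.2 (Finset.mem_image_of_mem _ (Fintype.mem_piFinset.2 hU)),
      Set.mem_iInter.2 hx⟩
  · exact Finset.card_image_le.trans (by simp)

lemma HasFiniteSubcover.joinPull {G X : Type*} (α : G → X → X) {𝒰 : Set (Set X)}
    (h : HasFiniteSubcover 𝒰) {n : ℕ} (g : Fin n → G) :
    HasFiniteSubcover (joinPull α 𝒰 g) := by
  obtain ⟨F, hF, hc⟩ := h
  obtain ⟨F', hF', hc', -⟩ := exists_subcover_joinPull α hF hc g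
  exact ⟨F', hF', hc'⟩

lemma bddAbove_coverN_joinPull {G X : Type*} (α : G → X → X) {𝒰 : Set (Set X)}
    (h : HasFiniteSubcover 𝒰) (n : ℕ) :
    BddAbove {m : ℕ | ∃ g : Fin n → G, m = coverN (joinPull α 𝒰 g)} := by
  obtain ⟨F, hF, hc⟩ := h
  refine ⟨F.card ^ n, ?_⟩
  rintro _ ⟨g, rfl⟩
  obtain ⟨F', hF', hc', hcard⟩ := exists_subcover_joinPull α hF hc g
  exact (coverN_le_card F' hF' hc').trans hcard

lemma coverN_joinPull_le_patN {G X : Type*} (α : G → X → X) {𝒰 : Set (Set X)}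
    (h : HasFiniteSubcover 𝒰) {n : ℕ} (g : Fin n → G) :
    coverN (joinPull α 𝒰 g) ≤ patN α 𝒰 n :=
  le_csSup (bddAbove_coverN_joinPull α h n) ⟨g, rfl⟩

lemma exists_patN_eq_coverN {G X : Type*} [Nonempty G] (α : G → X → X) {𝒰 : Set (Set X)}
    (h : HasFiniteSubcover 𝒰) (n : ℕ) :
    ∃ g : Fin n → G, patN α 𝒰 n = coverN (joinPull α 𝒰 g) :=
  Nat.sSup_mem (s := {m : ℕ | ∃ g : Fin n → G, m = coverN (joinPull α 𝒰 g)})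
    ⟨_, fun _ => Classical.arbitrary G, rfl⟩ (bddAbove_coverN_joinPull α h n)

/-- `N` of a join is monotone in the set of group elements and invariant under right
translation of that set. -/
lemma coverN_joinPull_le_of_mul_mem_range {G X : Type*} [Group G] [TopologicalSpace X]
    {α : G → X → X} (hα : IsActionBy α) {𝒰 : Set (Set X)} (hfin : HasFiniteSubcover 𝒰)
    {n m : ℕ} {g : Fin n → G} {g' : Fin m → G} (h : G)
    (hg : ∀ i, g i * h ∈ Set.range g') :
    coverN (joinPull α 𝒰 g) ≤ coverN (joinPull α 𝒰 g') := by
  choose j hj using hg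
  refine coverN_le_coverN_of_preimage_subset (hfin.joinPull α g') (α h⁻¹) ?_
  rintro _ ⟨U, hU, rfl⟩
  refine ⟨_, ⟨fun i => U (j i), fun i => hU _, rfl⟩, fun x hx => Set.mem_iInter.2 fun i => ?_⟩
  have := Set.mem_iInter.1 hx (j i)
  rwa [Set.mem_preimage, hj, ← hα.2.1, mul_inv_cancel_right] at this

/-- Maximal patterns can be realised by sets of `n` distinct elements avoiding a given
finite set. -/
lemma exists_maximal_pattern_disjoint {G X : Type*} [Group G] [Infinite G] [TopologicalSpace X]
    {α : G → X → X} (hα : IsActionBy α) {𝒰 : Set (Set X)} (hfin : HasFiniteSubcover 𝒰)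
    (E : Finset G) (n : ℕ) :
    ∃ T : Finset G, T.card = n ∧ Disjoint E T ∧
      ∀ (m : ℕ) (g' : Fin m → G), (T : Set G) ⊆ Set.range g' →
        patN α 𝒰 n ≤ coverN (joinPull α 𝒰 g') := by
  obtain ⟨g, hg⟩ := exists_patN_eq_coverN α hfin n
  obtain ⟨S, hS, hcard⟩ := Infinite.exists_superset_card_eq (Finset.univ.image g) n
    (Finset.card_image_le.trans (by simp))
  obtain ⟨h, hh⟩ := Infinite.exists_notMem_finset (Finset.image₂ (fun s e => s⁻¹ * e) S E)
  refine ⟨S.map (mulRightEmbedding h), by simp [hcard], ?_, fun m g' hg' => ?_⟩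
  · refine Finset.disjoint_left.2 fun e he hmem => hh ?_
    obtain ⟨s, hs, rfl⟩ := Finset.mem_map.1 hmem
    exact Finset.mem_image₂.2 ⟨s, hs, _, he, by simp⟩
  · rw [hg]
    exact coverN_joinPull_le_of_mul_mem_range hα hfin h fun i => hg' <| Finset.mem_coe.2 <|
      Finset.mem_map_of_mem (mulRightEmbedding h) (hS (Finset.mem_image_of_mem g (by simp)))

/-- An increasing chain of duplicate-free lists of unbounded length is the chain of initial
segments of an injective sequence. -/
lemma exists_injective_of_prefix_chain {G : Type*} {L : ℕ → List G}
    (hpre : ∀ k, L k <+: L (k + 1)) (hnd : ∀ k, (L k).Nodup) (hlen : ∀ k, k ≤ (L k).length) :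
    ∃ s : ℕ → G, Function.Injective s ∧
      ∀ k, ∀ x ∈ L k, x ∈ Set.range fun i : Fin (L k).length => s i := by
  have hmono : ∀ {a b : ℕ}, a ≤ b → L a <+: L b := fun {a b} hab => by
    induction b, hab using Nat.le_induction with
    | base => exact List.prefix_rfl
    | succ b _ ih => exact ih.trans (hpre b)
  have hs : ∀ k i (hi : i < (L k).length), (L (i + 1))[i]'(hlen (i + 1)) = (L k)[i] := by
    intro k i hi
    rcases le_total (i + 1) k with h | h
    · exact (hmono h).getElem _
    · exact ((hmono h).getElem hi).symm
  refine ⟨fun i => (L (i + 1))[i]'(hlen (i + 1)), fun i j hij => ?_, fun k x hx => ?_⟩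
  · have hi : i < (L (i + j + 1)).length := by have := hlen (i + j + 1); omega
    have hj : j < (L (i + j + 1)).length := by have := hlen (i + j + 1); omega
    have hij : (L (i + 1))[i]'(hlen (i + 1)) = (L (j + 1))[j]'(hlen (j + 1)) := hij
    rw [hs _ i hi, hs _ j hj] at hij
    exact (hnd (i + j + 1)).getElem_inj_iff.1 hij
  · obtain ⟨i, hi, rfl⟩ := List.getElem_of_mem hx
    exact ⟨⟨i, hi⟩, hs k i hi⟩

/-- The limsup of a sequence is a limit of values that are frequently attained or exceeded. -/
lemma exists_tendsto_limsup_frequently_le (a : ℕ → ℝ≥0∞) :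
    ∃ c : ℕ → ℝ≥0∞, Tendsto c atTop (𝓝 (atTop.limsup a)) ∧ ∀ k, ∃ᶠ n in atTop, c k ≤ a n := by
  rcases eq_or_ne (atTop.limsup a) 0 with h0 | h0
  · exact ⟨fun _ => 0, by simp [h0], fun k => (Eventually.of_forall fun _ => zero_le).frequently⟩
  · obtain ⟨c, -, hc, hlim⟩ := exists_seq_strictMono_tendsto' (pos_iff_ne_zero.2 h0)
    exact ⟨c, hlim, fun k => (frequently_lt_of_lt_limsup (by isBoundedDefault)
      (hc k).2).mono fun _ => le_of_lt⟩

/-- Adding a comparatively short initial segment to a block changes averages little. -/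
lemma ofReal_div_le_mul_of_mul_le {x y : ℝ} (hy : 0 ≤ y) (hxy : x ≤ y) {k l n : ℕ}
    (hn : 0 < n) (hl : (k + 1) * l ≤ n) :
    ENNReal.ofReal (x / n) ≤
      ENNReal.ofReal (y / (l + n : ℕ)) * ENNReal.ofReal (1 + 1 / ((k : ℝ) + 1)) := by
  rw [← ENNReal.ofReal_mul (by positivity)]
  refine ENNReal.ofReal_le_ofReal ?_
  have hn' : (0 : ℝ) < n := by exact_mod_cast hn
  have hl' : ((k : ℝ) + 1) * l ≤ n := by exact_mod_cast hl
  have hratio : ((l + n : ℕ) : ℝ) ≤ (1 + 1 / ((k : ℝ) + 1)) * n := by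
    have : (l : ℝ) ≤ n / ((k : ℝ) + 1) := by
      rw [le_div_iff₀ (by positivity)]; linarith
    push_cast
    calc (l : ℝ) + n ≤ n / ((k : ℝ) + 1) + n := by linarith
      _ = _ := by ring
  have hpos : (0 : ℝ) < (l + n : ℕ) := by positivity
  rw [div_mul_eq_mul_div, div_le_div_iff₀ hn' hpos]
  calc x * (l + n : ℕ) ≤ y * (l + n : ℕ) := by gcongr
    _ ≤ y * ((1 + 1 / ((k : ℝ) + 1)) * n) := by gcongr
    _ = _ := by ring

/-- If arbitrarily late terms of `b` are at least `c k / (1 + 1 / (k + 1))` and `c` tends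
to `h`, then `h ≤ limsup b`. -/
lemma le_limsup_of_le_mul {b c : ℕ → ℝ≥0∞} {h : ℝ≥0∞} {m : ℕ → ℕ}
    (hc : Tendsto c atTop (𝓝 h)) (hm : Tendsto m atTop atTop)
    (hle : ∀ k, c k ≤ b (m k) * ENNReal.ofReal (1 + 1 / ((k : ℝ) + 1))) :
    h ≤ atTop.limsup b := by
  by_contra! hlt
  obtain ⟨d, hbd, hdh⟩ := exists_between hlt
  have hev : ∀ᶠ k in atTop, b (m k) < d :=
    hm.eventually (eventually_lt_of_limsup_lt hbd (by isBoundedDefault))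
  have hlim : Tendsto (fun k : ℕ => d * ENNReal.ofReal (1 + 1 / ((k : ℝ) + 1))) atTop (𝓝 d) := by
    have h1 : Tendsto (fun k : ℕ => ENNReal.ofReal (1 + 1 / ((k : ℝ) + 1))) atTop (𝓝 1) := by
      simpa using ENNReal.tendsto_ofReal
        (tendsto_one_div_add_atTop_nhds_zero_nat (𝕜 := ℝ).const_add 1)
    simpa using ENNReal.Tendsto.const_mul h1 (Or.inl one_ne_zero)
  refine hdh.not_ge (le_of_tendsto_of_tendsto hc hlim ?_)
  filter_upwards [hev] with k hk
  exact (hle k).trans (by gcongr)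

/-- Huang–Ye: for every open cover `𝒰` there is a sequence `𝔰` of pairwise
distinct elements of `G` with `h*_top(𝒰,G) = h^𝔰_top(𝒰,G)`. -/
theorem maximal_pattern_entropy_cover_eq_seq_entropy_along_some_sequence
    {G X : Type*} [Group G] [Countable G] [Infinite G] [MetricSpace X] [CompactSpace X]
    (α : G → X → X) (hα : IsActionBy α) (𝒰 : Set (Set X)) (h𝒰 : IsOpenCover 𝒰) :
    ∃ 𝔰 : ℕ → G, Function.Injective 𝔰 ∧ patEntCover α 𝒰 = seqEntCover α 𝔰 𝒰 := by
  have hfin := h𝒰.hasFiniteSubcover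
  obtain ⟨c, hc, hfreq⟩ := exists_tendsto_limsup_frequently_le
    fun n : ℕ => ENNReal.ofReal (Real.log (patN α 𝒰 n) / n)
  have step : ∀ (k : ℕ) (l : {l : List G // l.Nodup}), ∃ l' : {l : List G // l.Nodup},
      l.1 <+: l'.1 ∧ ∃ n, l'.1.length = l.1.length + n ∧ 0 < n ∧ (k + 1) * l.1.length ≤ n ∧
        c k ≤ ENNReal.ofReal (Real.log (patN α 𝒰 n) / n) ∧
        ∀ (m : ℕ) (g' : Fin m → G), (∀ x ∈ l'.1, x ∈ Set.range g') →
          patN α 𝒰 n ≤ coverN (joinPull α 𝒰 g') := by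
    intro k l
    obtain ⟨n, hn, hck⟩ := frequently_atTop.1 (hfreq k) ((k + 1) * l.1.length + 1)
    obtain ⟨T, hcard, hdisj, hT⟩ := exists_maximal_pattern_disjoint hα hfin l.1.toFinset n
    refine ⟨⟨l.1 ++ T.toList, l.2.append T.nodup_toList fun x hx hx' => ?_⟩,
      List.prefix_append _ _, n, by simp [hcard], by omega, by omega, hck,
      fun m g' hg' => hT m g' fun x hx => hg' x (by simpa using Or.inr hx)⟩
    exact Finset.disjoint_left.1 hdisj (List.mem_toFinset.2 hx) (Finset.mem_toList.1 hx')
  choose next hpre n hlen hpos hshort hcn hpat using step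
  let L : ℕ → {l : List G // l.Nodup} := fun k => Nat.rec ⟨[], List.nodup_nil⟩ next k
  have hL : ∀ k, k ≤ (L k).1.length := by
    intro k
    induction k with
    | zero => exact Nat.zero_le _
    | succ k ih =>
      have h1 : (L (k + 1)).1.length = _ := hlen k (L k)
      have h2 := hpos k (L k)
      omega
  obtain ⟨s, hinj, hs⟩ := exists_injective_of_prefix_chain (L := fun k => (L k).1)
    (fun k => hpre k (L k)) (fun k => (L k).2) hL
  refine ⟨s, hinj, le_antisymm ?_ ?_⟩
  · refine le_limsup_of_le_mul (m := fun k => (L (k + 1)).1.length) hc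
      (tendsto_atTop_mono (fun k => (Nat.le_succ k).trans (hL (k + 1))) tendsto_id) fun k => ?_
    have hle := hpat k (L k) _ _ (hs (k + 1))
    have hlog : Real.log (patN α 𝒰 (n k (L k))) ≤ Real.log (coverN (joinPull α 𝒰
        fun i : Fin (L (k + 1)).1.length => s i)) := by
      rcases Nat.eq_zero_or_pos (patN α 𝒰 (n k (L k))) with h0 | h0
      · simpa [h0] using Real.log_natCast_nonneg _
      · exact Real.log_le_log (by exact_mod_cast h0) (by exact_mod_cast hle)
    have hmain := ofReal_div_le_mul_of_mul_le (Real.log_natCast_nonneg _) hlog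
      (hpos k (L k)) (hshort k (L k))
    rw [← hlen k (L k)] at hmain
    exact (hcn k (L k)).trans hmain
  · refine limsup_le_limsup (Eventually.of_forall fun n => ENNReal.ofReal_le_ofReal ?_)
    have hle := coverN_joinPull_le_patN α hfin fun i : Fin n => s i
    rcases Nat.eq_zero_or_pos (coverN (joinPull α 𝒰 fun i : Fin n => s i)) with h0 | h0
    · simpa [h0] using div_nonneg (Real.log_natCast_nonneg _) (Nat.cast_nonneg n)
    · gcongr
end

section
/- Let (X,G,α) be a topological dynamical system and let (A_1,…,A_k) be a tuple of closed subsets of X which has arbitrarily large finite independence sets. Then there exists an IN-tuple (x_1,…,x_k) with x_j ∈ A_j for all 1 ≤ j ≤ k. -/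
open Filter Topology Set
open scoped ENNReal Classical

namespace Finset

/-- The end-homogeneous step of Ramsey's theorem: if Ramsey's theorem holds for `m`-subsets, then
large finite sets contain large subsets on whose `(m + 1)`-subsets the colour depends only on the
minimum. -/
theorem exists_subset_color_eq_of_min {ι κ : Type*} [LinearOrder ι] [Inhabited κ] {m : ℕ}
    (ramsey : ∀ L : ℕ, ∃ N : ℕ, ∀ F : Finset ι, N ≤ F.card → ∀ c : Finset ι → κ,
      ∃ H ⊆ F, H.card = L ∧ ∃ d : κ, ∀ s ⊆ H, s.card = m → c s = d) (L : ℕ) :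
    ∃ N : ℕ, ∀ F : Finset ι, N ≤ F.card → ∀ c : Finset ι → κ,
      ∃ H ⊆ F, H.card = L ∧ ∃ d : ι → κ, ∀ s ⊆ H, s.card = m + 1 →
        ∀ x ∈ s, (∀ y ∈ s, x ≤ y) → c s = d x := by
  induction L with
  | zero =>
    refine ⟨0, fun F _ c => ⟨∅, by simp, rfl, fun _ => default, fun s hs h => ?_⟩⟩
    simp [subset_empty.mp hs] at h
  | succ L ih =>
    obtain ⟨N₁, h₁⟩ := ih
    obtain ⟨N₂, h₂⟩ := ramsey N₁
    refine ⟨N₂ + 1, fun F hF c => ?_⟩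
    have hne : F.Nonempty := card_pos.mp (by omega)
    set a := F.min' hne
    have haF : a ∈ F := F.min'_mem hne
    obtain ⟨H₂, hH₂, hc₂, d₂, hd₂⟩ := h₂ (F.erase a) (by rw [card_erase_of_mem haF]; omega)
      (fun s => c (insert a s))
    obtain ⟨H₁, hH₁, hc₁, d₁, hd₁⟩ := h₁ H₂ hc₂.ge c
    have haH : a ∉ H₁ := fun h => notMem_erase a F (hH₂ (hH₁ h))
    have hmin : ∀ y ∈ H₁, a ≤ y := fun y hy => F.min'_le y (mem_of_mem_erase (hH₂ (hH₁ hy)))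
    refine ⟨insert a H₁, ?_, by rw [card_insert_of_notMem haH, hc₁],
      Function.update d₁ a d₂, fun s hs hsc x hx hxm => ?_⟩
    · exact insert_subset haF ((hH₁.trans hH₂).trans (erase_subset _ _))
    by_cases has : a ∈ s
    · have hxa : x = a := by
        rcases mem_insert.mp (hs hx) with h | h
        · exact h
        · exact le_antisymm (hxm a has) (hmin x h)
      subst hxa
      rw [Function.update_self]
      have := hd₂ (s.erase a) ((subset_insert_iff.mp hs).trans hH₁)
        (by rw [card_erase_of_mem has]; omega)
      rwa [insert_erase has] at this
    · have hsH : s ⊆ H₁ := (subset_insert_iff_of_notMem has).mp hs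
      rw [Function.update_of_ne (by rintro rfl; exact has hx)]
      exact hd₁ s hsH hsc x hx hxm

/-- **Finite Ramsey theorem** for finite colourings of the `m`-element subsets. -/
theorem exists_ramsey (ι κ : Type*) [LinearOrder ι] [Inhabited κ] [Finite κ] (m L : ℕ) :
    ∃ N : ℕ, ∀ F : Finset ι, N ≤ F.card → ∀ c : Finset ι → κ,
      ∃ H ⊆ F, H.card = L ∧ ∃ d : κ, ∀ s ⊆ H, s.card = m → c s = d := by
  induction m generalizing L with
  | zero =>
    refine ⟨L, fun F hF c => ?_⟩
    obtain ⟨H, hH, hc⟩ := exists_subset_card_eq hF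
    exact ⟨H, hH, hc, c ∅, fun s _ hs => by rw [card_eq_zero.mp hs]⟩
  | succ m ih =>
    have := Fintype.ofFinite κ
    obtain ⟨N, hN⟩ := exists_subset_color_eq_of_min ih (Fintype.card κ * L)
    refine ⟨N, fun F hF c => ?_⟩
    obtain ⟨H, hH, hc, d, hd⟩ := hN F hF c
    obtain ⟨y, -, hy⟩ := exists_le_card_fiber_of_mul_le_card_of_maps_to
      (s := H) (t := (univ : Finset κ)) (f := d) (n := L) (fun _ _ => mem_univ _)
      univ_nonempty (by rw [card_univ, hc])
    obtain ⟨H', hH', hc'⟩ := exists_subset_card_eq hy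
    refine ⟨H', (hH'.trans (filter_subset _ _)).trans hH, hc', y, fun s hs hsc => ?_⟩
    have hne : s.Nonempty := card_pos.mp (by omega)
    rw [hd s (hs.trans (hH'.trans (filter_subset _ _))) hsc _ (s.min'_mem hne)
      fun z hz => s.min'_le z hz]
    exact (mem_filter.mp (hH' (hs (s.min'_mem hne)))).2

end Finset

section Independence

variable {G X : Type*} {α : G → X → X} {k : ℕ}

theorem HasArbLargeIndep.mono {A B : Fin k → Set X} (h : HasArbLargeIndep α A)
    (hAB : ∀ i, A i ⊆ B i) : HasArbLargeIndep α B := fun n => by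
  obtain ⟨F, hF, hI⟩ := h n
  refine ⟨F, hF, fun E hE hne ω => (hI E hE hne ω).mono ?_⟩
  exact iInter₂_mono fun g _ => preimage_mono (hAB _)

theorem HasArbLargeIndep.nonempty {A : Fin k → Set X} (h : HasArbLargeIndep α A) (j : Fin k) :
    (A j).Nonempty := by
  obtain ⟨F, hF, hI⟩ := h 1
  have hne : F.Nonempty := Finset.card_pos.mp hF
  obtain ⟨g, hg⟩ := hne
  obtain ⟨x, hx⟩ := hI F subset_rfl ⟨g, hg⟩ fun _ => j
  exact ⟨α g x, mem_iInter₂.mp hx g hg⟩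

/-- If the `j`-th set of a tuple with arbitrarily large finite independence sets is covered by two
sets, then replacing it by one of the two yields independence sets of any given size. -/
theorem exists_isIndepSet_update [Countable G] {U : Fin k → Set X} {j : Fin k} (B : Bool → Set X)
    (h : HasArbLargeIndep α (Function.update U j (⋃ ε, B ε))) (m : ℕ) (hm : 0 < m) :
    ∃ ε, ∃ F : Finset G, F.card = m ∧ IsIndepSet α (Function.update U j (B ε)) ↑F := by
  obtain ⟨e, he⟩ := exists_injective_nat G
  let : LinearOrder G := LinearOrder.lift' e he
  have hk : 0 < k := j.pos
  let P (f : Fin m → G) (τ : Fin m → Fin k) (ε : Bool) : Prop :=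
    ∃ x, ∀ i, α (f i) x ∈ Function.update U j (B ε) (τ i)
  obtain ⟨N, hN⟩ := Finset.exists_ramsey G (Set ((Fin m → Fin k) × Bool)) m (2 * m * k)
  obtain ⟨F, hF, hI⟩ := h N
  obtain ⟨H, hHF, hHc, d, hd⟩ := hN F hF
    fun s => {p | ∀ f : Fin m → G, StrictMono f → Set.range f = s → P f p.1 p.2}
  let φ : Fin (2 * m * k) ↪o G := H.orderEmbOfFin hHc
  have hφ : ∀ i, φ i ∈ H := H.orderEmbOfFin_mem hHc
  have hmk : 0 < 2 * m * k := by positivity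
  let ω : G → Fin k :=
    Function.extend φ (fun p => ⟨p % k, Nat.mod_lt _ hk⟩) fun _ => j
  obtain ⟨x, hx⟩ := hI H (by exact_mod_cast hHF) ⟨_, hφ ⟨0, hmk⟩⟩ ω
  let pos (b : Fin (2 * m)) (l : Fin k) : Fin (2 * m * k) :=
    ⟨b * k + l, by have := b.2; have := l.2; nlinarith⟩
  have hpos : ∀ b l, α (φ (pos b l)) x ∈ Function.update U j (⋃ ε, B ε) l := fun b l => by
    have := mem_iInter₂.mp hx _ (hφ (pos b l))
    have hω : ω (φ (pos b l)) = l := by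
      simp only [ω, φ.injective.extend_apply, pos]
      ext
      simp [Nat.mod_eq_of_lt l.2]
    rwa [hω] at this
  have hcol : ∀ b, ∃ ε, α (φ (pos b j)) x ∈ B ε := fun b => by
    simpa using hpos b j
  choose col hcol using hcol
  obtain ⟨ε, -, hε⟩ := Finset.exists_le_card_fiber_of_mul_le_card_of_maps_to
    (s := Finset.univ) (t := Finset.univ) (f := col) (n := m) (fun _ _ => Finset.mem_univ _)
    Finset.univ_nonempty (by simp)
  obtain ⟨T, hT, hTc⟩ := Finset.exists_subset_card_eq hε
  have hreal : ∀ τ : Fin m → Fin k, (τ, ε) ∈ d := fun τ => by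
    let f (i : Fin m) : G := φ (pos (T.orderEmbOfFin hTc i) (τ i))
    have hf : StrictMono f := fun i i' hii => by
      refine φ.strictMono ?_
      have h1 : (T.orderEmbOfFin hTc i : ℕ) < T.orderEmbOfFin hTc i' :=
        (T.orderEmbOfFin hTc).strictMono hii
      have h2 := (τ i).2
      change (_ : ℕ) < _
      simp only [pos]
      nlinarith
    have hs : Finset.univ.image f ⊆ H := by
      intro y hy
      obtain ⟨i, -, rfl⟩ := Finset.mem_image.mp hy
      exact hφ _
    rw [← hd _ hs (by rw [Finset.card_image_of_injective _ hf.injective]; simp)]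
    intro f' hf' hr
    have : f' = f := (hf'.range_inj hf).mp (by rw [hr]; simp)
    subst this
    refine ⟨x, fun i => ?_⟩
    change α (φ (pos _ (τ i))) x ∈ Function.update U j (B ε) (τ i)
    by_cases hi : τ i = j
    · have hb := hcol (T.orderEmbOfFin hTc i)
      have hc := (Finset.mem_filter.mp (hT (T.orderEmbOfFin_mem hTc i))).2
      rw [hc] at hb
      rwa [hi, Function.update_self]
    · simpa [Function.update_of_ne hi] using hpos (T.orderEmbOfFin hTc i) (τ i)
  obtain ⟨J, hJH, hJc⟩ := Finset.exists_subset_card_eq (s := H) (n := m) (by rw [hHc]; nlinarith)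
  refine ⟨ε, J, hJc, fun E hE _ ω' => ?_⟩
  have h1 := hreal (ω' ∘ J.orderEmbOfFin hJc)
  rw [← hd J hJH hJc] at h1
  obtain ⟨y, hy⟩ := h1 (J.orderEmbOfFin hJc) (J.orderEmbOfFin hJc).strictMono
    (J.range_orderEmbOfFin hJc)
  refine ⟨y, mem_iInter₂.mpr fun g hg => ?_⟩
  have hgJ : g ∈ Set.range (J.orderEmbOfFin hJc) := by
    rw [J.range_orderEmbOfFin hJc]; exact hE hg
  obtain ⟨i, rfl⟩ := hgJ
  exact hy i

theorem HasArbLargeIndep.update_union [Countable G] {U : Fin k → Set X} {j : Fin k} {B C : Set X}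
    (h : HasArbLargeIndep α (Function.update U j (B ∪ C))) :
    HasArbLargeIndep α (Function.update U j B) ∨ HasArbLargeIndep α (Function.update U j C) := by
  by_contra! hcon
  simp only [HasArbLargeIndep, not_forall, not_exists, not_and] at hcon
  obtain ⟨⟨n₁, h₁⟩, n₂, h₂⟩ := hcon
  rw [union_eq_iUnion] at h
  obtain ⟨ε, F, hF, hI⟩ := exists_isIndepSet_update _ h (max n₁ n₂ + 1) (by omega)
  cases ε
  · exact h₂ F (by omega) hI
  · exact h₁ F (by omega) hI

/-- A tuple of compact sets with arbitrarily large finite independence sets can be localised at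
points in any finite set of coordinates. -/
theorem HasArbLargeIndep.exists_localized [Countable G] [TopologicalSpace X] {A : Fin k → Set X}
    (hA : ∀ i, IsCompact (A i)) (h : HasArbLargeIndep α A) (s : Finset (Fin k)) :
    ∃ x : Fin k → X, (∀ i, x i ∈ A i) ∧ ∀ U : Fin k → Set X,
      (∀ i ∈ s, U i ∈ 𝓝[A i] (x i)) → (∀ i ∉ s, A i ⊆ U i) → HasArbLargeIndep α U := by
  induction s using Finset.induction_on with
  | empty =>
    choose x hx using h.nonempty
    exact ⟨x, hx, fun U _ hU => h.mono fun i => hU i (by simp)⟩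
  | insert j s hj ih =>
    obtain ⟨x, hx, hU⟩ := ih
    suffices ∃ y ∈ A j, ∀ t ∈ 𝓝[A j] y, ∀ U : Fin k → Set X,
        (∀ i ∈ s, U i ∈ 𝓝[A i] (x i)) → (∀ i ∉ s, i ≠ j → A i ⊆ U i) →
        HasArbLargeIndep α (Function.update U j t) by
      obtain ⟨y, hy, hyU⟩ := this
      refine ⟨Function.update x j y, fun i => ?_, fun U h₁ h₂ => ?_⟩
      · rcases eq_or_ne i j with rfl | hij
        · simpa using hy
        · simpa [hij] using hx i
      · have := hyU (U j) (by simpa using h₁ j (by simp)) U (fun i hi => ?_)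
          fun i hi hij => h₂ i (by simp [hi, hij])
        · simpa using this
        · have hij : i ≠ j := by rintro rfl; exact hj hi
          simpa [hij] using h₁ i (by simp [hi])
    by_contra! hcon
    have key := (hA j).induction_on (p := fun t => ∃ U : Fin k → Set X,
        (∀ i ∈ s, U i ∈ 𝓝[A i] (x i)) ∧ (∀ i ∉ s, i ≠ j → A i ⊆ U i) ∧
        ¬ HasArbLargeIndep α (Function.update U j t)) ?_ ?_ ?_ hcon
    · obtain ⟨U, h₁, h₂, h₃⟩ := key
      refine h₃ (hU _ (fun i hi => ?_) fun i hi => ?_)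
      · have hij : i ≠ j := by rintro rfl; exact hj hi
        simpa [hij] using h₁ i hi
      · rcases eq_or_ne i j with rfl | hij
        · simp
        · simpa [hij] using h₂ i hi hij
    · refine ⟨A, fun i _ => self_mem_nhdsWithin, fun i _ _ => subset_rfl, fun hE => ?_⟩
      simpa using hE.nonempty j
    · rintro t t' htt ⟨U, h₁, h₂, h₃⟩
      exact ⟨U, h₁, h₂, fun h₄ => h₃ (h₄.mono (Function.update_mono htt))⟩
    · rintro t t' ⟨U, h₁, h₂, h₃⟩ ⟨U', h₁', h₂', h₃'⟩
      refine ⟨fun i => U i ∩ U' i, fun i hi => inter_mem (h₁ i hi) (h₁' i hi),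
        fun i hi hij => subset_inter (h₂ i hi hij) (h₂' i hi hij), fun h₄ => ?_⟩
      rcases h₄.update_union with h₅ | h₅
      · exact h₃ (h₅.mono (update_le_update_iff.mpr ⟨le_rfl, fun i _ => inter_subset_left⟩))
      · exact h₃' (h₅.mono (update_le_update_iff.mpr ⟨le_rfl, fun i _ => inter_subset_right⟩))

end Independence

/-- Kerr–Li: a tuple of closed sets with arbitrarily large finite independence
sets contains an IN-tuple. -/
theorem exists_INTuple_of_closed_hasArbLargeIndep
    {G X : Type*} [Group G] [Countable G] [Infinite G] [MetricSpace X] [CompactSpace X]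
    (α : G → X → X) (hα : IsActionBy α) {k : ℕ} (A : Fin k → Set X)
    (hA : ∀ i, IsClosed (A i)) (hind : HasArbLargeIndep α A) :
    ∃ x : Fin k → X, IsINTuple α x ∧ ∀ j, x j ∈ A j := by
  obtain ⟨x, hx, hU⟩ := hind.exists_localized (fun i => (hA i).isCompact) Finset.univ
  exact ⟨x, fun U hUo hxU => hU U
    (fun i _ => mem_nhdsWithin_of_mem_nhds ((hUo i).mem_nhds (hxU i))) (by simp), hx⟩
end

section
/- Let G be an abelian countably infinite discrete group and (X,G,α) a topological dynamical system. Then (X,G,α) is weak-mixing if and only if (X,G,α) has uniform positive sequence entropy (u.p.s.e.), i.e. every pair in X²\Δ_2(X) is a sequence entropy pair. -/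
open Filter Topology Set
open scoped ENNReal Classical

section WeakMixing

variable {G X : Type*} [TopologicalSpace X] {α : G → X → X}

/-- A finite family of transition conditions is implied by a single one, provided
the acting group is abelian and the action is weak-mixing. -/
theorem IsWeakMixing.exists_open_forall_transition [CommGroup G] [Nonempty X]
    (hα : IsActionBy α) (h : IsWeakMixing α) {ι : Type*} (s : Finset ι) (U V : ι → Set X)
    (hU : ∀ i, IsOpen (U i) ∧ (U i).Nonempty) (hV : ∀ i, IsOpen (V i) ∧ (V i).Nonempty) :
    ∃ U' V' : Set X, IsOpen U' ∧ IsOpen V' ∧ U'.Nonempty ∧ V'.Nonempty ∧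
      ∀ g, (∃ x ∈ V', α g x ∈ U') → ∀ i ∈ s, ∃ x ∈ V i, α g x ∈ U i := by
  induction s using Finset.induction_on with
  | empty => exact ⟨univ, univ, isOpen_univ, isOpen_univ, univ_nonempty, univ_nonempty, by simp⟩
  | insert j s _ ih =>
    obtain ⟨U', V', hU', hV', nU', nV', ih⟩ := ih
    obtain ⟨a, ⟨_, hu, u, hu', rfl⟩, ⟨_, hv, v, hv', rfl⟩⟩ :=
      h (U j) (V j) U' V' (hU j).1 (hV j).1 hU' hV' (hU j).2 (hV j).2 nU' nV'
    refine ⟨U' ∩ α a ⁻¹' U j, V' ∩ α a ⁻¹' V j, hU'.inter ((hU j).1.preimage (hα.2.2 a)),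
      hV'.inter ((hV j).1.preimage (hα.2.2 a)), ⟨u, hu', hu⟩, ⟨v, hv', hv⟩, ?_⟩
    rintro g ⟨x, ⟨hx, hxa⟩, hgx, hgxa⟩ i hi
    rcases Finset.mem_insert.1 hi with rfl | hi
    · refine ⟨α a x, hxa, ?_⟩
      rw [← hα.2.1, mul_comm, hα.2.1]
      exact hgxa
    · exact ih g ⟨x, hx, hgx⟩ i hi

/-- A weak-mixing action of an abelian group is weak-mixing of all orders. -/
theorem IsWeakMixing.exists_forall_transition [CommGroup G] [Nonempty X]
    (hα : IsActionBy α) (h : IsWeakMixing α) {ι : Type*} [Fintype ι] (U V : ι → Set X)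
    (hU : ∀ i, IsOpen (U i) ∧ (U i).Nonempty) (hV : ∀ i, IsOpen (V i) ∧ (V i).Nonempty) :
    ∃ g, ∀ i, ∃ x ∈ V i, α g x ∈ U i := by
  obtain ⟨U', V', hU', hV', nU', nV', H⟩ :=
    h.exists_open_forall_transition hα Finset.univ U V hU hV
  obtain ⟨g, ⟨_, hu, v, hv, rfl⟩, -⟩ := h U' U' V' V' hU' hU' hV' hV' nU' nU' nV' nV'
  exact ⟨g, fun i => H g ⟨v, hv, hu⟩ i (Finset.mem_univ i)⟩

/-- In a weak-mixing system of an abelian group, every pair of nonempty open sets is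
independent along some sequence. -/
theorem IsWeakMixing.exists_independent_seq [CommGroup G] [Nonempty X]
    (hα : IsActionBy α) (h : IsWeakMixing α) (U : Bool → Set X)
    (hU : ∀ b, IsOpen (U b) ∧ (U b).Nonempty) :
    ∃ 𝔰 : ℕ → G, ∀ (n : ℕ) (ω : ℕ → Bool), ∃ x, ∀ i < n, α (𝔰 i) x ∈ U (ω i) := by
  let Good (n : ℕ) (𝔰 : ℕ → G) : Prop := ∀ ω : ℕ → Bool, ∃ x, ∀ i < n, α (𝔰 i) x ∈ U (ω i)
  have step (n : ℕ) (𝔰 : {𝔰 // Good n 𝔰}) :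
      ∃ 𝔱 : {𝔱 // Good (n + 1) 𝔱}, ∀ i < n, 𝔱.1 i = 𝔰.1 i := by
    obtain ⟨𝔰, h𝔰⟩ := 𝔰
    obtain ⟨a, ha⟩ := h.exists_forall_transition hα (ι := (Fin n → Bool) × Bool)
      (fun p => U p.2) (fun p => ⋂ i : Fin n, α (𝔰 i) ⁻¹' U (p.1 i)) (fun p => hU p.2)
      (fun p => by
        refine ⟨isOpen_iInter_of_finite fun i => (hU _).1.preimage (hα.2.2 _), ?_⟩
        obtain ⟨x, hx⟩ := h𝔰 fun i => if hi : i < n then p.1 ⟨i, hi⟩ else true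
        exact ⟨x, mem_iInter.2 fun i => by simpa using hx i i.2⟩)
    refine ⟨⟨Function.update 𝔰 n a, fun ω => ?_⟩, fun i hi => Function.update_of_ne hi.ne _ _⟩
    obtain ⟨x, hx, hax⟩ := ha (fun i => ω i, ω n)
    refine ⟨x, fun i hi => ?_⟩
    rcases Nat.lt_succ_iff_lt_or_eq.1 hi with hi | rfl
    · rw [Function.update_of_ne hi.ne]
      exact mem_iInter.1 hx ⟨i, hi⟩
    · simpa using hax
  choose next hnext using step
  let T : ∀ n, {𝔰 // Good n 𝔰} := fun n =>
    Nat.rec ⟨fun _ => 1, fun _ => ⟨Classical.arbitrary X, by simp⟩⟩ next n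
  have hT (i k : ℕ) : (T (i + 1 + k)).1 i = (T (i + 1)).1 i := by
    induction k with
    | zero => rfl
    | succ k ih => exact (hnext (i + 1 + k) (T (i + 1 + k)) i (by omega)).trans ih
  refine ⟨fun i => (T (i + 1)).1 i, fun n ω => ?_⟩
  obtain ⟨x, hx⟩ := (T n).2 ω
  refine ⟨x, fun i hi => ?_⟩
  obtain ⟨k, rfl⟩ := Nat.exists_eq_add_of_le (Nat.succ_le_of_lt hi)
  have hxi := hx i hi
  rwa [show (T (i.succ + k)).1 i = _ from hT i k] at hxi

/-- For an abelian group, it suffices to test weak-mixing on quadruples `U, U, U, V`. -/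
theorem isWeakMixing_of_forall_exists_transition [CommGroup G] (hα : IsActionBy α)
    (h : ∀ U V : Set X, IsOpen U → IsOpen V → U.Nonempty → V.Nonempty →
      ∃ g, (∃ x ∈ U, α g x ∈ U) ∧ ∃ x ∈ V, α g x ∈ U) :
    IsWeakMixing α := by
  intro U₁ U₂ V₁ V₂ hU₁ hU₂ hV₁ hV₂ nU₁ nU₂ nV₁ nV₂
  have hinv (g : G) (x : X) : α g⁻¹ (α g x) = x := by rw [← hα.2.1, inv_mul_cancel, hα.1]
  have hcomm (g k : G) (x : X) : α g (α k x) = α k (α g x) := by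
    rw [← hα.2.1, mul_comm, hα.2.1]
  obtain ⟨a, -, u, hu, hau⟩ := h U₂ U₁ hU₂ hU₁ nU₂ nU₁
  set U := U₁ ∩ α a ⁻¹' U₂
  have hU : IsOpen U := hU₁.inter (hU₂.preimage (hα.2.2 a))
  obtain ⟨v₂, hv₂⟩ := nV₂
  obtain ⟨b, -, v, hv, hbv⟩ := h U V₁ hU hV₁ ⟨u, hu, hau⟩ nV₁
  have hWopen : IsOpen (α (b⁻¹ * a) ⁻¹' V₂) := hV₂.preimage (hα.2.2 _)
  have hWne : (α (b⁻¹ * a) ⁻¹' V₂).Nonempty := by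
    refine ⟨α (b⁻¹ * a)⁻¹ v₂, ?_⟩
    rwa [mem_preimage, hcomm, hinv]
  obtain ⟨g, ⟨x, ⟨-, hxV⟩, hgx, -⟩, y, hy, hgy, -⟩ :=
    h (U ∩ α b⁻¹ ⁻¹' V₁) (α (b⁻¹ * a) ⁻¹' V₂) (hU.inter (hV₁.preimage (hα.2.2 _))) hWopen
      ⟨α b v, hbv, by rwa [mem_preimage, hinv]⟩ hWne
  have key (z : X) : α (g * b) (α b⁻¹ z) = α g z := by
    rw [← hα.2.1, mul_inv_cancel_right]
  refine ⟨g * b, ⟨α g x, hgx.1, α b⁻¹ x, hxV, key x⟩, ⟨α a (α g y), hgy.2, _, hy, ?_⟩⟩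
  rw [hα.2.1 b⁻¹ a, key, hcomm]

end WeakMixing

section CoverCounting

variable {G X : Type*} {α : G → X → X} {A₁ A₂ : Set X}

/-- The cover number along `n` group elements is at least `2 ^ n` if the sets whose complements
form the cover are independent along these elements. -/
theorem two_pow_le_coverN_joinPull (hA : Disjoint A₁ A₂) {n : ℕ} (g : Fin n → G)
    (h : ∀ ω : Fin n → Bool, ∃ x, ∀ i, α (g i) x ∈ if ω i then A₁ else A₂) :
    2 ^ n ≤ coverN (joinPull α {A₁ᶜ, A₂ᶜ} g) := by
  refine le_csInf ?_ ?_
  · let W (ω : Fin n → Bool) : Set X := ⋂ i, α (g i) ⁻¹' (if ω i then A₁ᶜ else A₂ᶜ)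
    refine ⟨_, Finset.univ.image W, ?_, rfl, ?_⟩
    · intro V hV
      obtain ⟨ω, -, rfl⟩ := Finset.mem_image.1 hV
      exact ⟨fun i => if ω i then A₁ᶜ else A₂ᶜ, fun i => by by_cases hi : ω i <;> simp [hi], rfl⟩
    · refine eq_univ_of_forall fun x => mem_sUnion.2
        ⟨W fun i => decide (α (g i) x ∉ A₁), by simp, mem_iInter.2 fun i => ?_⟩
      by_cases hi : α (g i) x ∈ A₁
      · simpa [hi] using disjoint_left.1 hA hi
      · simp [hi]
  · rintro _ ⟨F, hF, rfl, hcov⟩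
    choose x hx using h
    have hmem (ω : Fin n → Bool) : ∃ V ∈ F, x ω ∈ V := by
      have : x ω ∈ ⋃₀ (F : Set (Set X)) := hcov ▸ mem_univ _
      simpa using this
    choose V hVF hV using hmem
    have hinj : Function.Injective V := by
      intro ω ω' heq
      obtain ⟨U, hU, hVU⟩ := hF (hVF ω)
      have h₁ := hVU ▸ hV ω
      have h₂ := hVU ▸ heq ▸ hV ω'
      funext i
      have h₁ := mem_iInter.1 h₁ i
      have h₂ := mem_iInter.1 h₂ i
      have e₁ := hx ω i
      have e₂ := hx ω' i
      rcases hU i with hUi | hUi <;> rw [hUi] at h₁ h₂ <;>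
        cases hi : ω i <;> cases hi' : ω' i <;> simp_all
    calc 2 ^ n = (Finset.univ : Finset (Fin n → Bool)).card := by simp
      _ ≤ F.card := Finset.card_le_card_of_injOn V (fun ω _ => hVF ω) hinj.injOn

/-- If no group element carries both some point of `A₁` and some point of `A₂` into `A₁`, then
cover numbers grow at most linearly. -/
theorem coverN_joinPull_le [Group G] [TopologicalSpace X] (hα : IsActionBy α)
    (h : ∀ g, ¬ ((∃ x ∈ A₁, α g x ∈ A₁) ∧ ∃ x ∈ A₂, α g x ∈ A₁)) {n : ℕ} (g : Fin n → G) :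
    coverN (joinPull α {A₁ᶜ, A₂ᶜ} g) ≤ n + 1 := by
  let W (o : Option (Fin n)) : Fin n → Set X := fun j =>
    if ∃ i ∈ o, ∃ x ∈ A₁, α (g i * (g j)⁻¹) x ∈ A₁ then A₂ᶜ else A₁ᶜ
  have htrans (i j : Fin n) (x : X) : α (g i * (g j)⁻¹) (α (g j) x) = α (g i) x := by
    rw [← hα.2.1, inv_mul_cancel_right]
  let F : Finset (Set X) := Finset.univ.image fun o => ⋂ j, α (g j) ⁻¹' W o j
  have hcard : F.card ≤ n + 1 := Finset.card_image_le.trans (by simp)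
  refine le_trans (Nat.sInf_le ⟨F, ?_, rfl, ?_⟩) hcard
  · intro V hV
    obtain ⟨o, -, rfl⟩ := Finset.mem_image.1 hV
    refine ⟨W o, fun j => ?_, rfl⟩
    simp only [W]
    split_ifs <;> simp
  · refine eq_univ_of_forall fun x => ?_
    suffices ∃ o, ∀ j, α (g j) x ∈ W o j by
      obtain ⟨o, ho⟩ := this
      exact mem_sUnion.2 ⟨_, Finset.mem_image_of_mem _ (Finset.mem_univ o), mem_iInter.2 ho⟩
    by_cases hx : ∃ i, α (g i) x ∈ A₁
    · obtain ⟨i, hi⟩ := hx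
      refine ⟨some i, fun j => ?_⟩
      simp only [W, Option.mem_some_iff, exists_eq_left']
      split_ifs with hc
      · exact fun hj => h _ ⟨hc, _, hj, (htrans i j x).symm ▸ hi⟩
      · exact fun hj => hc ⟨_, hj, (htrans i j x).symm ▸ hi⟩
    · exact ⟨none, fun j => by simpa [W] using fun hj => hx ⟨j, hj⟩⟩

/-- Linear growth of cover numbers forces zero sequence entropy. -/
theorem seqEntCover_eq_zero_of_coverN_le {𝒰 : Set (Set X)} {𝔰 : ℕ → G}
    (h : ∀ n : ℕ, coverN (joinPull α 𝒰 fun i : Fin n => 𝔰 i) ≤ n + 1) :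
    seqEntCover α 𝔰 𝒰 = 0 := by
  have hlim : Tendsto (fun n : ℕ => Real.log (n + 1) / n) atTop (𝓝 0) := by
    have h₁ : Tendsto (fun x : ℝ => Real.log (x + 1) / x) atTop (𝓝 0) := by
      have h₂ := Real.tendsto_pow_log_div_mul_add_atTop 1 (-1) 1 one_ne_zero
      have h₃ := h₂.comp (tendsto_atTop_add_const_right atTop (1 : ℝ) tendsto_id)
      simpa [Function.comp_def] using h₃
    exact h₁.comp tendsto_natCast_atTop_atTop
  have hle (n : ℕ) : Real.log (coverN (joinPull α 𝒰 fun i : Fin n => 𝔰 i)) / n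
      ≤ Real.log (n + 1) / n := by
    refine div_le_div_of_nonneg_right ?_ n.cast_nonneg
    rcases Nat.eq_zero_or_pos (coverN (joinPull α 𝒰 fun i : Fin n => 𝔰 i)) with h0 | h0
    · rw [h0, Nat.cast_zero, Real.log_zero]
      exact Real.log_nonneg (by simp)
    · exact Real.log_le_log (by exact_mod_cast h0) (by exact_mod_cast h n)
  have hlim' : Tendsto (fun n : ℕ => ENNReal.ofReal (Real.log (n + 1) / n)) atTop (𝓝 0) := by
    simpa using ENNReal.tendsto_ofReal hlim
  exact (tendsto_of_tendsto_of_tendsto_of_le_of_le tendsto_const_nhds hlim' (fun _ => zero_le)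
    fun n => ENNReal.ofReal_le_ofReal (hle n)).limsup_eq

/-- Exponential growth of cover numbers forces positive sequence entropy. -/
theorem seqEntCover_pos_of_two_pow_le_coverN {𝒰 : Set (Set X)} {𝔰 : ℕ → G}
    (h : ∀ n : ℕ, 2 ^ n ≤ coverN (joinPull α 𝒰 fun i : Fin n => 𝔰 i)) :
    0 < seqEntCover α 𝔰 𝒰 := by
  have hle : ENNReal.ofReal (Real.log 2) ≤ seqEntCover α 𝔰 𝒰 := by
    refine le_limsup_of_frequently_le (Eventually.frequently ?_) (by isBoundedDefault)
    filter_upwards [eventually_gt_atTop 0] with n hn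
    refine ENNReal.ofReal_le_ofReal ?_
    rw [le_div_iff₀ (by exact_mod_cast hn), mul_comm, ← Real.log_pow]
    exact Real.log_le_log (by positivity) (by exact_mod_cast h n)
  exact (ENNReal.ofReal_pos.2 (Real.log_pos one_lt_two)).trans_le hle

end CoverCounting

/-- Huang–Li–Shao–Ye: for abelian `G`, weak-mixing iff u.p.s.e. -/
theorem weakMixing_iff_upse_of_abelian
    {G X : Type*} [CommGroup G] [Countable G] [Infinite G] [MetricSpace X] [CompactSpace X]
    (α : G → X → X) (hα : IsActionBy α) :
    IsWeakMixing α ↔ ∀ x₁ x₂ : X, x₁ ≠ x₂ → IsSeqEntropyPair α x₁ x₂ := by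
  constructor
  · intro h x₁ x₂ hne
    refine ⟨hne, fun A₁ A₂ _ _ hA₁ hA₂ hdisj => ?_⟩
    have : Nonempty X := ⟨x₁⟩
    obtain ⟨𝔰, h𝔰⟩ := h.exists_independent_seq hα
      (fun b => if b then interior A₁ else interior A₂) (fun b => by
        cases b
        · exact ⟨isOpen_interior, x₂, mem_interior_iff_mem_nhds.2 hA₂⟩
        · exact ⟨isOpen_interior, x₁, mem_interior_iff_mem_nhds.2 hA₁⟩)
    refine ⟨𝔰, seqEntCover_pos_of_two_pow_le_coverN fun n =>
      two_pow_le_coverN_joinPull hdisj _ fun ω => ?_⟩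
    obtain ⟨x, hx⟩ := h𝔰 n fun i => if hi : i < n then ω ⟨i, hi⟩ else true
    refine ⟨x, fun i => ?_⟩
    have hxi := hx i i.2
    cases hi : ω i <;> simp only [Fin.is_lt, dite_true, Fin.eta, hi, if_true] at hxi ⊢ <;>
      exact interior_subset hxi
  · intro h
    refine isWeakMixing_of_forall_exists_transition hα fun U V hU hV ⟨u, hu⟩ ⟨v, hv⟩ => ?_
    by_cases huv : u = v
    · subst huv
      exact ⟨1, ⟨u, hu, (hα.1 u).symm ▸ hu⟩, u, hv, (hα.1 u).symm ▸ hu⟩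
    obtain ⟨P, Q, hP, hQ, huP, hvQ, hPQ⟩ := t2_separation huv
    obtain ⟨A₁, hA₁, hcA₁, hAU⟩ :=
      exists_mem_nhds_isClosed_subset ((hU.inter hP).mem_nhds ⟨hu, huP⟩)
    obtain ⟨A₂, hA₂, hcA₂, hAV⟩ :=
      exists_mem_nhds_isClosed_subset ((hV.inter hQ).mem_nhds ⟨hv, hvQ⟩)
    have hdisj : Disjoint A₁ A₂ :=
      hPQ.mono (hAU.trans inter_subset_right) (hAV.trans inter_subset_right)
    obtain ⟨𝔰, h𝔰⟩ := (h u v huv).2 A₁ A₂ hcA₁ hcA₂ hA₁ hA₂ hdisj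
    by_contra hcon
    refine h𝔰.ne' (seqEntCover_eq_zero_of_coverN_le fun n => coverN_joinPull_le hα ?_ _)
    rintro g ⟨⟨x, hx, hgx⟩, y, hy, hgy⟩
    exact hcon ⟨g, ⟨x, (hAU hx).1, (hAU hgx).1⟩, y, (hAV hy).1, (hAU hgy).1⟩
end
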